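/- arXiv:2508.04083 — 4 statements merged into one kernel-verified Lean document; each statement's English description precedes it below -/
import Mathlib

section
/- Let p be a real polynomial of degree at least 2 all of whose coefficients are nonnegative, with p(0) = 0 and p′(0) > 1. Assume moreover that p has no negative real fixed point (i.e. p(x) ≠ x for all x < 0) and that every complex root of the derivative p′ is real. Then the Julia set of the induced map P : ℂ → ℂ, z ↦ p(z) — that is, the frontier of the set of points z ∈ ℂ whose forward orbit {P^[n](z) : n ≥ 0} is bounded — is totally disconnected. (In particular, under these hypotheses p(x) < x and p^[n](x) → −∞ for every real x < 0.) -/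
section

open Set Metric Filter Topology ComplexConjugate Polynomial

/-- The square of the pseudo-hyperbolic distance on the unit disc. -/
noncomputable def pseudoHypSq (z w : ℂ) : ℝ :=
  Complex.normSq (z - w) / Complex.normSq (1 - conj w * z)

theorem normSq_one_sub_conj_mul (z w : ℂ) :
    Complex.normSq (1 - conj w * z) =
      Complex.normSq (z - w) + (1 - Complex.normSq z) * (1 - Complex.normSq w) := by
  simp only [Complex.normSq_apply, Complex.sub_re, Complex.sub_im, Complex.mul_re, Complex.mul_im,
    Complex.conj_re, Complex.conj_im, Complex.one_re, Complex.one_im]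
  ring

theorem normSq_lt_one {z : ℂ} (hz : ‖z‖ < 1) : Complex.normSq z < 1 := by
  rw [Complex.normSq_eq_norm_sq]
  nlinarith [norm_nonneg z]

theorem normSq_one_sub_conj_mul_pos {z w : ℂ} (hz : ‖z‖ < 1) (hw : ‖w‖ < 1) :
    0 < Complex.normSq (1 - conj w * z) := by
  rw [normSq_one_sub_conj_mul]
  have := mul_pos (sub_pos.2 (normSq_lt_one hz)) (sub_pos.2 (normSq_lt_one hw))
  linarith [Complex.normSq_nonneg (z - w)]

theorem one_sub_conj_mul_ne_zero {z w : ℂ} (hz : ‖z‖ < 1) (hw : ‖w‖ < 1) :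
    1 - conj w * z ≠ 0 :=
  Complex.normSq_pos.1 (normSq_one_sub_conj_mul_pos hz hw)

theorem pseudoHypSq_nonneg (z w : ℂ) : 0 ≤ pseudoHypSq z w :=
  div_nonneg (Complex.normSq_nonneg _) (Complex.normSq_nonneg _)

theorem pseudoHypSq_lt_one {z w : ℂ} (hz : ‖z‖ < 1) (hw : ‖w‖ < 1) : pseudoHypSq z w < 1 := by
  rw [pseudoHypSq, div_lt_one (normSq_one_sub_conj_mul_pos hz hw), normSq_one_sub_conj_mul]
  linarith [mul_pos (sub_pos.2 (normSq_lt_one hz)) (sub_pos.2 (normSq_lt_one hw))]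

theorem eq_of_pseudoHypSq_nonpos {z w : ℂ} (hz : ‖z‖ < 1) (hw : ‖w‖ < 1)
    (h : pseudoHypSq z w ≤ 0) : z = w := by
  have h' := le_antisymm h (pseudoHypSq_nonneg z w)
  rw [pseudoHypSq, div_eq_zero_iff, or_iff_left (normSq_one_sub_conj_mul_pos hz hw).ne',
    Complex.normSq_eq_zero, sub_eq_zero] at h'
  exact h'

/-- The disc automorphism sending `a` to `0`. -/
noncomputable def discAut (a z : ℂ) : ℂ := (z - a) / (1 - conj a * z)

theorem normSq_discAut (a z : ℂ) : Complex.normSq (discAut a z) = pseudoHypSq z a := by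
  rw [discAut, pseudoHypSq, Complex.normSq_div]

theorem norm_discAut_lt_one {a z : ℂ} (ha : ‖a‖ < 1) (hz : ‖z‖ < 1) : ‖discAut a z‖ < 1 := by
  have := pseudoHypSq_lt_one hz ha
  rw [← normSq_discAut, Complex.normSq_eq_norm_sq] at this
  nlinarith [norm_nonneg (discAut a z)]

theorem differentiableOn_discAut {a : ℂ} (ha : ‖a‖ < 1) :
    DifferentiableOn ℂ (discAut a) (ball 0 1) := by
  unfold discAut
  refine DifferentiableOn.div (by fun_prop) (by fun_prop) fun z hz => ?_
  exact one_sub_conj_mul_ne_zero (mem_ball_zero_iff.1 hz) ha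

theorem discAut_neg_discAut {a z : ℂ} (ha : ‖a‖ < 1) (hz : ‖z‖ < 1) :
    discAut (-a) (discAut a z) = z := by
  have h1 := one_sub_conj_mul_ne_zero hz ha
  have h2 := one_sub_conj_mul_ne_zero ha ha
  have h3 : (1 - conj a * z) + conj a * (z - a) ≠ 0 := by
    rwa [show (1 - conj a * z) + conj a * (z - a) = 1 - conj a * a by ring]
  simp only [discAut, map_neg]
  rw [div_eq_iff]
  · rw [sub_neg_eq_add, div_add' _ _ _ h1, div_eq_iff h1, mul_assoc, sub_mul, one_mul,
      mul_assoc, div_mul_cancel₀ _ h1]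
    ring
  · rw [show 1 - -conj a * ((z - a) / (1 - conj a * z)) =
      ((1 - conj a * z) + conj a * (z - a)) / (1 - conj a * z) by field_simp; ring]
    exact div_ne_zero h3 h1

/-- The **Schwarz–Pick lemma** for the pseudo-hyperbolic distance. -/
theorem pseudoHypSq_le_of_mapsTo {f : ℂ → ℂ} (hd : DifferentiableOn ℂ f (ball 0 1))
    (hf : MapsTo f (ball 0 1) (ball 0 1)) {u v : ℂ} (hu : ‖u‖ < 1) (hv : ‖v‖ < 1) :
    pseudoHypSq (f u) (f v) ≤ pseudoHypSq u v := by
  have hv' : ‖-v‖ < 1 := by rwa [norm_neg]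
  have hfv : ‖f v‖ < 1 := mem_ball_zero_iff.1 (hf (mem_ball_zero_iff.2 hv))
  have hm : MapsTo (discAut (-v)) (ball 0 1) (ball 0 1) := fun z hz =>
    mem_ball_zero_iff.2 (norm_discAut_lt_one hv' (mem_ball_zero_iff.1 hz))
  have hm2 : MapsTo (discAut (f v)) (ball 0 1) (closedBall 0 1) := fun z hz =>
    ball_subset_closedBall <|
      mem_ball_zero_iff.2 (norm_discAut_lt_one hfv (mem_ball_zero_iff.1 hz))
  have key := Complex.norm_le_norm_of_mapsTo_ball (f := discAut (f v) ∘ f ∘ discAut (-v))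
    (z := discAut v u)
    ((differentiableOn_discAut hfv).comp (hd.comp (differentiableOn_discAut hv') hm)
      (hf.comp hm)) (hm2.comp (hf.comp hm)) (by simp [discAut]) (norm_discAut_lt_one hv hu)
  simp only [Function.comp_apply, discAut_neg_discAut hv hu] at key
  rw [← normSq_discAut, ← normSq_discAut, Complex.normSq_eq_norm_sq, Complex.normSq_eq_norm_sq]
  gcongr

theorem pseudoHypSq_sq (z w : ℂ) :
    pseudoHypSq (z ^ 2) (w ^ 2) = pseudoHypSq z w * pseudoHypSq z (-w) := by
  simp only [pseudoHypSq]
  rw [div_mul_div_comm, ← map_mul, ← map_mul]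
  congr 2
  · ring
  · simp only [map_pow, map_neg]
    ring

theorem pseudoHypSq_le_of_normSq_le {z w : ℂ} {r : ℝ} (hr : r < 1)
    (hz : Complex.normSq z ≤ r) (hw : Complex.normSq w ≤ r) :
    pseudoHypSq z w ≤ 1 - (1 - r) ^ 2 / 4 := by
  have lt_one : ∀ x : ℂ, Complex.normSq x ≤ r → ‖x‖ < 1 := fun x hx => by
    rw [Complex.normSq_eq_norm_sq] at hx
    nlinarith [norm_nonneg x]
  have hz1 := lt_one z hz
  have hw1 := lt_one w hw
  have hpos := normSq_one_sub_conj_mul_pos hz1 hw1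
  have hle : Complex.normSq (1 - conj w * z) ≤ 4 := by
    have h : ‖1 - conj w * z‖ ≤ 2 := by
      calc ‖1 - conj w * z‖ ≤ ‖(1 : ℂ)‖ + ‖conj w * z‖ := norm_sub_le _ _
        _ ≤ 2 := by
          rw [norm_mul, RCLike.norm_conj, norm_one]
          nlinarith [norm_nonneg z, norm_nonneg w]
    rw [Complex.normSq_eq_norm_sq]
    nlinarith [norm_nonneg (1 - conj w * z)]
  rw [pseudoHypSq, div_le_iff₀ hpos]
  have h1 := normSq_one_sub_conj_mul z w
  have h2 : (1 - r) ^ 2 ≤ (1 - Complex.normSq z) * (1 - Complex.normSq w) := by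
    rw [sq]
    gcongr
    all_goals linarith
  nlinarith [sq_nonneg (1 - r)]

/-- The branch of the square root on the slit plane. -/
noncomputable def slitSqrt (z : ℂ) : ℂ := Complex.exp (Complex.log z / 2)

theorem slitSqrt_sq {z : ℂ} (hz : z ≠ 0) : slitSqrt z ^ 2 = z := by
  rw [slitSqrt, ← Complex.exp_nat_mul, Nat.cast_ofNat, mul_div_cancel₀ _ two_ne_zero,
    Complex.exp_log hz]

theorem re_slitSqrt_pos {z : ℂ} (hz : z ∈ Complex.slitPlane) : 0 < (slitSqrt z).re := by
  rw [slitSqrt, Complex.exp_re]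
  refine mul_pos (Real.exp_pos _) (Real.cos_pos_of_mem_Ioo ?_)
  have h1 := Complex.neg_pi_lt_arg z
  have h2 := lt_of_le_of_ne (Complex.arg_le_pi z) (Complex.slitPlane_arg_ne_pi hz)
  have h3 : (Complex.log z / 2).im = z.arg / 2 := by
    rw [Complex.div_ofNat_im, Complex.log_im]
  rw [h3]
  constructor <;> linarith

theorem differentiableAt_slitSqrt {z : ℂ} (hz : z ∈ Complex.slitPlane) :
    DifferentiableAt ℂ slitSqrt z := by
  unfold slitSqrt
  fun_prop (disch := assumption)

theorem sq_mem_slitPlane {a : ℂ} (ha : 0 < a.re) : a ^ 2 ∈ Complex.slitPlane := by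
  rw [Complex.mem_slitPlane_iff, sq, Complex.mul_re, Complex.mul_im]
  by_cases h : a.im = 0
  · left
    rw [h]
    nlinarith
  · right
    rw [mul_comm a.im, ← two_mul]
    positivity

/-- A holomorphic self-map of the disc that avoids the radius `(-1, 0]` contracts the
pseudo-hyperbolic distance of points with images in a smaller disc. -/
theorem pseudoHypSq_le_of_mapsTo_slitPlane {g : ℂ → ℂ} (hd : DifferentiableOn ℂ g (ball 0 1))
    (hg : MapsTo g (ball 0 1) (ball 0 1)) (hg' : MapsTo g (ball 0 1) Complex.slitPlane)
    {u v : ℂ} (hu : ‖u‖ < 1) (hv : ‖v‖ < 1) {r : ℝ} (hr : r < 1)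
    (hgu : ‖g u‖ ≤ r) (hgv : ‖g v‖ ≤ r) :
    pseudoHypSq (g u) (g v) ≤ (1 - (1 - r) ^ 2 / 4) * pseudoHypSq u v := by
  have hsq : ∀ z ∈ ball (0 : ℂ) 1, slitSqrt (g z) ^ 2 = g z := fun z hz =>
    slitSqrt_sq (Complex.slitPlane_ne_zero (hg' hz))
  have hn : ∀ z ∈ ball (0 : ℂ) 1, Complex.normSq (slitSqrt (g z)) = ‖g z‖ := fun z hz => by
    rw [Complex.normSq_eq_norm_sq, ← norm_pow, hsq z hz]
  have hu' := mem_ball_zero_iff.2 hu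
  have hv' := mem_ball_zero_iff.2 hv
  have hpick : pseudoHypSq (slitSqrt (g u)) (slitSqrt (g v)) ≤ pseudoHypSq u v := by
    refine pseudoHypSq_le_of_mapsTo (f := fun z => slitSqrt (g z)) ?_ ?_ hu hv
    · exact fun z hz => (differentiableAt_slitSqrt (hg' hz)).comp_differentiableWithinAt z (hd z hz)
    · intro z hz
      have h1 := hn z hz
      have h2 := mem_ball_zero_iff.1 (hg hz)
      rw [Complex.normSq_eq_norm_sq] at h1
      rw [mem_ball_zero_iff]
      nlinarith [norm_nonneg (slitSqrt (g z))]
  have hle : pseudoHypSq (slitSqrt (g u)) (-slitSqrt (g v)) ≤ 1 - (1 - r) ^ 2 / 4 :=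
    pseudoHypSq_le_of_normSq_le hr (by rwa [hn u hu']) (by rwa [Complex.normSq_neg, hn v hv'])
  have key := pseudoHypSq_sq (slitSqrt (g u)) (slitSqrt (g v))
  rw [hsq u hu', hsq v hv'] at key
  rw [key, mul_comm]
  exact mul_le_mul hle hpick (pseudoHypSq_nonneg _ _) ((pseudoHypSq_nonneg _ _).trans hle)

/-- The Riemann map of `{z | z - c ∈ slitPlane}` onto the unit disc sending `c + s ^ 2` to `0`. -/
noncomputable def slitToDisc (c s : ℝ) (z : ℂ) : ℂ :=
  (slitSqrt (z - c) - s) / (slitSqrt (z - c) + s)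

/-- The inverse of `slitToDisc c s`. -/
noncomputable def discToSlit (c s : ℝ) (w : ℂ) : ℂ := c + (s * ((1 + w) / (1 - w))) ^ 2

theorem add_ofReal_ne_zero {a : ℂ} {s : ℝ} (ha : 0 < a.re) (hs : 0 < s) : a + s ≠ 0 := fun h => by
  have := congrArg Complex.re h
  simp at this
  linarith

theorem norm_slitToDisc_lt_one {c s : ℝ} (hs : 0 < s) {z : ℂ} (hz : z - c ∈ Complex.slitPlane) :
    ‖slitToDisc c s z‖ < 1 := by
  have ha := re_slitSqrt_pos hz
  have h0 := add_ofReal_ne_zero ha hs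
  rw [slitToDisc, norm_div, div_lt_one (norm_pos_iff.2 h0), ← sq_lt_sq₀ (norm_nonneg _)
    (norm_nonneg _), ← Complex.normSq_eq_norm_sq, ← Complex.normSq_eq_norm_sq]
  simp only [Complex.normSq_apply, Complex.sub_re, Complex.sub_im, Complex.add_re, Complex.add_im,
    Complex.ofReal_re, Complex.ofReal_im]
  nlinarith [mul_pos ha hs]

theorem discToSlit_slitToDisc {c s : ℝ} (hs : 0 < s) {z : ℂ} (hz : z - c ∈ Complex.slitPlane) :
    discToSlit c s (slitToDisc c s z) = z := by
  have h0 := add_ofReal_ne_zero (re_slitSqrt_pos hz) hs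
  have hs' : (s : ℂ) ≠ 0 := by exact_mod_cast hs.ne'
  have h : (s : ℂ) * ((1 + slitToDisc c s z) / (1 - slitToDisc c s z)) = slitSqrt (z - c) := by
    have h1 : 1 + slitToDisc c s z = 2 * slitSqrt (z - c) / (slitSqrt (z - c) + s) := by
      rw [slitToDisc]; field_simp; ring
    have h2 : 1 - slitToDisc c s z = 2 * s / (slitSqrt (z - c) + s) := by
      rw [slitToDisc]; field_simp; ring
    rw [h1, h2]
    field_simp
  rw [discToSlit, h, slitSqrt_sq (Complex.slitPlane_ne_zero hz)]
  ring

theorem one_sub_ne_zero_of_norm_lt_one {w : ℂ} (hw : ‖w‖ < 1) : 1 - w ≠ 0 := fun h => by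
  rw [← sub_eq_zero.1 h] at hw
  simp at hw

theorem discToSlit_sub_mem_slitPlane {c s : ℝ} (hs : 0 < s) {w : ℂ} (hw : ‖w‖ < 1) :
    discToSlit c s w - c ∈ Complex.slitPlane := by
  rw [discToSlit, add_sub_cancel_left]
  apply sq_mem_slitPlane
  rw [Complex.re_ofReal_mul]
  refine mul_pos hs ?_
  have h1 := normSq_lt_one hw
  have h3 := Complex.normSq_pos.2 (one_sub_ne_zero_of_norm_lt_one hw)
  rw [Complex.div_re, ← add_div]
  refine div_pos ?_ h3
  simp only [Complex.normSq_apply, Complex.sub_re, Complex.sub_im, Complex.add_re, Complex.add_im,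
    Complex.one_re, Complex.one_im] at *
  nlinarith

theorem differentiableOn_discToSlit (c s : ℝ) :
    DifferentiableOn ℂ (discToSlit c s) (ball 0 1) := by
  unfold discToSlit
  have : DifferentiableOn ℂ (fun w : ℂ => (1 + w) / (1 - w)) (ball 0 1) :=
    DifferentiableOn.div (by fun_prop) (by fun_prop) fun w hw =>
      one_sub_ne_zero_of_norm_lt_one (mem_ball_zero_iff.1 hw)
  fun_prop

theorem differentiableAt_slitToDisc {c s : ℝ} (hs : 0 < s) {z : ℂ}
    (hz : z - c ∈ Complex.slitPlane) : DifferentiableAt ℂ (slitToDisc c s) z := by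
  have h : DifferentiableAt ℂ (fun z : ℂ => slitSqrt (z - c)) z :=
    DifferentiableAt.comp (g := slitSqrt) z (differentiableAt_slitSqrt hz) (by fun_prop)
  unfold slitToDisc
  exact (h.sub_const _).div (h.add_const _) (add_ofReal_ne_zero (re_slitSqrt_pos hz) hs)

theorem slitToDisc_mem_slitPlane {c s : ℝ} (hs : 0 < s) {z : ℂ}
    (hz : z - c ∈ Complex.slitPlane) (hz' : z - c - s ^ 2 ∈ Complex.slitPlane) :
    slitToDisc c s z ∈ Complex.slitPlane := by
  have ha := re_slitSqrt_pos hz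
  have hsq := slitSqrt_sq (Complex.slitPlane_ne_zero hz)
  have h0 := Complex.normSq_pos.2 (add_ofReal_ne_zero ha hs)
  rw [slitToDisc]
  rw [← hsq] at hz'
  set a := slitSqrt (z - c)
  rw [Complex.mem_slitPlane_iff] at hz' ⊢
  by_cases him : a.im = 0
  · left
    have h1 : s ^ 2 < a.re ^ 2 := by
      have : (a : ℂ) = (a.re : ℂ) := Complex.ext rfl (by simpa using him)
      rw [this] at hz'
      norm_cast at hz'
      simp at hz'
      exact hz'
    rw [Complex.div_re, ← add_div]
    refine div_pos ?_ h0
    simp [him]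
    nlinarith
  · right
    rw [Complex.div_im, ← sub_div]
    refine div_ne_zero ?_ h0.ne'
    simp
    intro h
    have : 2 * s * a.im = 0 := by linarith
    simp [him, hs.ne'] at this

/-- A holomorphic inverse branch of a polynomial along a map from the unit disc that avoids the
critical values. -/
theorem exists_differentiableOn_lift (P : ℂ[X]) {ψ : ℂ → ℂ}
    (hψ : DifferentiableOn ℂ ψ (ball 0 1))
    (hcrit : ∀ w ∈ ball (0 : ℂ) 1, ∀ z, P.eval z = ψ w → P.derivative.eval z ≠ 0)
    {w₀ z₀ : ℂ} (hw₀ : w₀ ∈ ball (0 : ℂ) 1) (h₀ : P.eval z₀ = ψ w₀) :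
    ∃ L : ℂ → ℂ, DifferentiableOn ℂ L (ball 0 1) ∧ L w₀ = z₀ ∧
      ∀ w ∈ ball (0 : ℂ) 1, P.eval (L w) = ψ w := by
  have : ContractibleSpace (ball (0 : ℂ) 1) := (convex_ball 0 1).contractibleSpace ⟨w₀, hw₀⟩
  have : LocallyPathConnectedSpace (ball (0 : ℂ) 1) := isOpen_ball.locallyPathConnectedSpace
  obtain ⟨F, ⟨hF₀, hF⟩, -⟩ := P.isCoveringMapOn_eval.existsUnique_continuousMap_lifts
    (⟨fun w : ball (0 : ℂ) 1 => ψ w, hψ.continuousOn.domRestrict⟩ : C(ball (0 : ℂ) 1, ℂ))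
    (a₀ := ⟨w₀, hw₀⟩) (e₀ := z₀) h₀
    (by rintro ⟨w, hw⟩ ⟨z, hz, hzw⟩; exact hcrit w hw z hzw hz)
  obtain ⟨L, hL⟩ : ∃ L : ℂ → ℂ, ∀ w : ball (0 : ℂ) 1, L w = F w :=
    ⟨Function.extend Subtype.val F 0, fun w => Subtype.val_injective.extend_apply _ _ _⟩
  have hPL : ∀ w ∈ ball (0 : ℂ) 1, P.eval (L w) = ψ w := fun w hw => by
    rw [hL ⟨w, hw⟩]
    exact congrFun hF ⟨w, hw⟩
  have hcont : ContinuousOn L (ball 0 1) := by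
    rw [continuousOn_iff_continuous_domRestrict]
    convert F.continuous using 1
    exact funext hL
  refine ⟨L, fun w hw => ?_, (hL ⟨w₀, hw₀⟩).trans hF₀, hPL⟩
  have hd := hcrit w hw (L w) (hPL w hw)
  have hPd := P.hasStrictDerivAt (L w)
  have hnhds := isOpen_ball.mem_nhds hw
  have hleft : ∀ᶠ x in 𝓝 (L w), hPd.localInverse P.eval _ _ hd (P.eval x) = x :=
    HasStrictDerivAt.eventually_left_inverse hPd hd
  have hinv := hPd.to_localInverse hd
  rw [hPL w hw] at hinv
  have heq : L =ᶠ[𝓝 w] hPd.localInverse P.eval _ _ hd ∘ ψ := by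
    filter_upwards [(hcont.continuousAt hnhds).eventually hleft, hnhds] with x hx hxb
    rw [Function.comp_apply, ← hPL x hxb, hx]
  exact ((hinv.hasDerivAt.differentiableAt.comp w (hψ.differentiableAt hnhds)).congr_of_eventuallyEq
    heq).differentiableWithinAt

/-- A continuous map `f` on a preconnected set `C` with `P ∘ f = P` that fixes one point of `C` is
the identity on `C`, provided that `P` has no critical values on `P '' C`. -/
theorem eq_self_of_eval_comp_eq (P : ℂ[X]) {C : Set ℂ} (hC : IsPreconnected C) {f : ℂ → ℂ}
    (hf : ContinuousOn f C) (heq : ∀ z ∈ C, P.eval (f z) = P.eval z)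
    (hcrit : ∀ z ∈ C, ∀ x, P.eval x = P.eval z → P.derivative.eval x ≠ 0)
    {a b : ℂ} (ha : a ∈ C) (hb : b ∈ C) (hfa : f a = a) : f b = b := by
  have hcov := P.isCoveringMapOn_eval.isCoveringMap_restrictPreimage
  have : PreconnectedSpace C := Subtype.preconnectedSpace hC
  have hmem : ∀ z ∈ C, P.eval z ∈ (P.eval '' {k | P.derivative.eval k = 0})ᶜ := by
    rintro z hz ⟨x, hx, hxz⟩
    exact hcrit z hz x hxz hx
  have hmem' : ∀ z : C, P.eval (f z) ∈ (P.eval '' {k | P.derivative.eval k = 0})ᶜ := fun z => by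
    rw [heq z z.2]
    exact hmem z z.2
  have key := hcov.eq_of_comp_eq
    (g₁ := fun z : C => ⟨f z, hmem' z⟩)
    (g₂ := fun z : C => ⟨z, hmem z z.2⟩)
    (hf.domRestrict.subtype_mk hmem') (continuous_subtype_val.subtype_mk _)
    (funext fun z => Subtype.ext (heq z z.2)) ⟨a, ha⟩ (Subtype.ext hfa)
  exact congrArg Subtype.val (congrFun key ⟨b, hb⟩)

/-- If the slit `(-∞, c]` contains all critical values of a polynomial `P` and `P` maps a longer slit
`(-∞, c + s ^ 2]` into it, then every compact forward invariant set disjoint from `(-∞, c]` is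
totally disconnected. -/
theorem isTotallyDisconnected_of_slit (P : ℂ[X]) {c s : ℝ} (hs : 0 < s) {K : Set ℂ}
    (hcrit : ∀ z, P.derivative.eval z = 0 → P.eval z - c ∉ Complex.slitPlane)
    (hpre : ∀ z, P.eval z - c ∈ Complex.slitPlane →
      z - c ∈ Complex.slitPlane ∧ z - c - s ^ 2 ∈ Complex.slitPlane)
    (hcpt : IsCompact K) (hslit : ∀ z ∈ K, z - c ∈ Complex.slitPlane)
    (hmaps : MapsTo P.eval K K) : IsTotallyDisconnected K := by
  obtain ⟨r, hr, hrK⟩ : ∃ r < 1, ∀ z ∈ K, ‖slitToDisc c s z‖ ≤ r := by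
    obtain rfl | hne := K.eq_empty_or_nonempty
    · exact ⟨0, one_pos, by simp⟩
    obtain ⟨x, hx, hmax⟩ := hcpt.exists_isMaxOn hne (f := fun z => ‖slitToDisc c s z‖)
      fun z hz => (differentiableAt_slitToDisc hs (hslit z hz)).continuousAt.norm.continuousWithinAt
    exact ⟨_, norm_slitToDisc_lt_one hs (hslit x hx), fun z hz => hmax hz⟩
  have contract : ∀ C ⊆ K, IsPreconnected C → ∀ a ∈ C, ∀ b ∈ C,
      pseudoHypSq (slitToDisc c s a) (slitToDisc c s b) ≤ (1 - (1 - r) ^ 2 / 4) *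
        pseudoHypSq (slitToDisc c s (P.eval a)) (slitToDisc c s (P.eval b)) := by
    intro C hCK hC a ha b hb
    have hdisc : ∀ z ∈ C, slitToDisc c s (P.eval z) ∈ ball (0 : ℂ) 1 := fun z hz =>
      mem_ball_zero_iff.2 (norm_slitToDisc_lt_one hs (hslit _ (hmaps (hCK hz))))
    have hinv : ∀ z ∈ C, discToSlit c s (slitToDisc c s (P.eval z)) = P.eval z := fun z hz =>
      discToSlit_slitToDisc hs (hslit _ (hmaps (hCK hz)))
    obtain ⟨L, hLd, hLa, hPL⟩ := exists_differentiableOn_lift P (differentiableOn_discToSlit c s)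
      (fun w hw z hz hz' => hcrit z hz' <| by
        rw [hz]
        exact discToSlit_sub_mem_slitPlane hs (mem_ball_zero_iff.1 hw))
      (hdisc a ha) (hinv a ha).symm
    have hLb : L (slitToDisc c s (P.eval b)) = b := by
      refine eq_self_of_eval_comp_eq P hC (f := fun z => L (slitToDisc c s (P.eval z))) ?_
        (fun z hz => (hPL _ (hdisc z hz)).trans (hinv z hz)) ?_ ha hb hLa
      · refine hLd.continuousOn.comp (fun z hz => ?_) hdisc
        exact ((differentiableAt_slitToDisc hs (hslit _ (hmaps (hCK hz)))).continuousAt.comp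
          (f := fun z => P.eval z) P.continuous.continuousAt).continuousWithinAt
      · intro z hz x hx hx'
        refine hcrit x hx' ?_
        rw [hx]
        exact hslit _ (hmaps (hCK hz))
    have hLs : ∀ w ∈ ball (0 : ℂ) 1,
        L w - c ∈ Complex.slitPlane ∧ L w - c - s ^ 2 ∈ Complex.slitPlane := fun w hw =>
      hpre _ <| by
        rw [hPL w hw]
        exact discToSlit_sub_mem_slitPlane hs (mem_ball_zero_iff.1 hw)
    have key := pseudoHypSq_le_of_mapsTo_slitPlane (g := fun w => slitToDisc c s (L w))
      (fun w hw => (differentiableAt_slitToDisc hs (hLs w hw).1).comp_differentiableWithinAt w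
        (hLd w hw))
      (fun w hw => mem_ball_zero_iff.2 (norm_slitToDisc_lt_one hs (hLs w hw).1))
      (fun w hw => slitToDisc_mem_slitPlane hs (hLs w hw).1 (hLs w hw).2)
      (mem_ball_zero_iff.1 (hdisc a ha)) (mem_ball_zero_iff.1 (hdisc b hb)) hr
      (by simpa only [hLa] using hrK a (hCK ha)) (by simpa only [hLb] using hrK b (hCK hb))
    simpa only [hLa, hLb] using key
  intro C hCK hC a ha b hb
  have hr0 : 0 ≤ r := (norm_nonneg _).trans (hrK a (hCK ha))
  have hlam0 : 0 ≤ 1 - (1 - r) ^ 2 / 4 := by nlinarith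
  have hlam1 : 1 - (1 - r) ^ 2 / 4 < 1 := by nlinarith [mul_pos (sub_pos.2 hr) (sub_pos.2 hr)]
  have iter : ∀ n : ℕ, ∀ C ⊆ K, IsPreconnected C → ∀ a ∈ C, ∀ b ∈ C,
      pseudoHypSq (slitToDisc c s a) (slitToDisc c s b) ≤ (1 - (1 - r) ^ 2 / 4) ^ n := by
    intro n
    induction n with
    | zero =>
      intro C hCK _ a ha b hb
      rw [pow_zero]
      exact (pseudoHypSq_lt_one (norm_slitToDisc_lt_one hs (hslit a (hCK ha)))
        (norm_slitToDisc_lt_one hs (hslit b (hCK hb)))).le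
    | succ n ih =>
      intro C hCK hC a ha b hb
      refine (contract C hCK hC a ha b hb).trans ?_
      rw [pow_succ' _ n]
      exact mul_le_mul_of_nonneg_left (ih (P.eval '' C) (hmaps.mono_left hCK).image_subset
        (hC.image _ P.continuous.continuousOn) _ (mem_image_of_mem _ ha) _ (mem_image_of_mem _ hb))
        hlam0
  have hle := ge_of_tendsto' (tendsto_pow_atTop_nhds_zero_of_lt_one hlam0 hlam1)
    fun n => iter n C hCK hC a ha b hb
  have heq := eq_of_pseudoHypSq_nonpos (norm_slitToDisc_lt_one hs (hslit a (hCK ha)))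
    (norm_slitToDisc_lt_one hs (hslit b (hCK hb))) hle
  rw [← discToSlit_slitToDisc hs (hslit a (hCK ha)), heq,
    discToSlit_slitToDisc hs (hslit b (hCK hb))]

/-- The filled-in Julia set of a polynomial. -/
def filledJulia (P : ℂ[X]) : Set ℂ :=
  {z | Bornology.IsBounded (range fun n => (fun w => P.eval w)^[n] z)}

theorem mem_filledJulia {P : ℂ[X]} {z : ℂ} :
    z ∈ filledJulia P ↔ ∃ B, ∀ n, ‖(fun w => P.eval w)^[n] z‖ ≤ B := by
  rw [filledJulia, mem_ofPred, isBounded_iff_forall_norm_le]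
  simp only [forall_mem_range]

theorem mapsTo_filledJulia (P : ℂ[X]) : MapsTo P.eval (filledJulia P) (filledJulia P) := by
  intro z hz
  obtain ⟨B, hB⟩ := mem_filledJulia.1 hz
  exact mem_filledJulia.2 ⟨B, fun n => by simpa using hB (n + 1)⟩

theorem isCompact_filledJulia {P : ℂ[X]} (hdeg : 2 ≤ P.natDegree) :
    IsCompact (filledJulia P) := by
  obtain ⟨R, hR0, hR⟩ : ∃ R : ℝ, 0 < R ∧ ∀ z : ℂ, R < ‖z‖ → 2 * ‖z‖ ≤ ‖P.eval z‖ := by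
    have hdeg' : 0 < P.divX.degree := by
      rw [← natDegree_pos_iff_degree_pos, natDegree_divX_eq_natDegree_tsub_one]
      omega
    have htend := P.divX.tendsto_norm_atTop hdeg' (z := id) tendsto_norm_cobounded_atTop
    have h3 : ∀ᶠ z : ℂ in Bornology.cobounded ℂ, 3 ≤ ‖P.divX.eval z‖ :=
      htend.eventually_ge_atTop 3
    have h4 : ∀ᶠ z : ℂ in Bornology.cobounded ℂ, ‖P.coeff 0‖ ≤ ‖z‖ :=
      tendsto_norm_cobounded_atTop.eventually_ge_atTop _
    obtain ⟨R, -, hR⟩ := (Metric.hasBasis_cobounded_compl_closedBall (0 : ℂ)).eventually_iff.1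
      (h3.and h4)
    refine ⟨max R 1, by positivity, fun z hz => ?_⟩
    obtain ⟨h5, h6⟩ := hR (x := z) (by simpa using (le_max_left _ _).trans_lt hz)
    have h7 : P.eval z = P.divX.eval z * z + P.coeff 0 := by
      conv_lhs => rw [← P.divX_mul_X_add]
      simp
    calc 2 * ‖z‖ ≤ ‖P.divX.eval z‖ * ‖z‖ - ‖P.coeff 0‖ := by nlinarith [norm_nonneg z]
      _ = ‖P.divX.eval z * z‖ - ‖P.coeff 0‖ := by rw [norm_mul]
      _ ≤ ‖P.eval z‖ := by
        rw [h7, sub_le_iff_le_add]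
        exact norm_le_add_norm_add _ _
  have hcont : ∀ n, Continuous (fun w => P.eval w)^[n] := fun n => P.continuous.iterate n
  have hesc : ∀ z : ℂ, R < ‖z‖ → ∀ n : ℕ, R < ‖(fun w => P.eval w)^[n] z‖ ∧
      2 ^ n * ‖z‖ ≤ ‖(fun w => P.eval w)^[n] z‖ := by
    intro z hz n
    induction n with
    | zero => simpa using hz
    | succ n ih =>
      rw [Function.iterate_succ_apply']
      have := hR _ ih.1
      refine ⟨by linarith [ih.1], ?_⟩
      rw [pow_succ']
      linarith [ih.2]
  have hsub : ∀ z ∈ filledJulia P, ‖z‖ ≤ R := by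
    intro z hz
    by_contra! hlt
    obtain ⟨B, hB⟩ := mem_filledJulia.1 hz
    obtain ⟨n, hn⟩ := pow_unbounded_of_one_lt (B / ‖z‖) one_lt_two
    rw [div_lt_iff₀ (hR0.trans hlt)] at hn
    linarith [(hesc z hlt n).2, hB n]
  have heq : filledJulia P = ⋂ n : ℕ, {z | ‖(fun w => P.eval w)^[n] z‖ ≤ R} := by
    ext z
    simp only [mem_iInter]
    refine ⟨fun hz n => hsub _ ((mapsTo_filledJulia P).iterate n hz), fun hz => ?_⟩
    exact mem_filledJulia.2 ⟨R, hz⟩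
  refine isCompact_of_isClosed_isBounded ?_ (isBounded_iff_forall_norm_le.2 ⟨R, hsub⟩)
  rw [heq]
  exact isClosed_iInter fun n => isClosed_le (hcont n).norm continuous_const

theorem sub_ofReal_mem_slitPlane {z : ℂ} {c : ℝ} (h : ∀ x : ℝ, x ≤ c → z ≠ x) :
    z - c ∈ Complex.slitPlane := by
  rw [Complex.mem_slitPlane_iff]
  by_contra! hz
  simp only [Complex.sub_re, Complex.ofReal_re, Complex.sub_im, Complex.ofReal_im, sub_zero] at hz
  exact h z.re (by linarith [hz.1]) (Complex.ext rfl (by simpa using hz.2))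

theorem sub_ofReal_notMem_slitPlane {x c : ℝ} (h : x ≤ c) :
    (x : ℂ) - c ∉ Complex.slitPlane := by
  rw [Complex.mem_slitPlane_iff]
  simpa using h

theorem eval_map_ofReal (p : ℝ[X]) (x : ℝ) :
    (p.map (algebraMap ℝ ℂ)).eval (x : ℂ) = (p.eval x : ℝ) := by
  rw [eval_map]
  exact eval₂_at_apply (algebraMap ℝ ℂ) x

theorem eval_lt_self_of_neg {p : ℝ[X]} (h0 : p.eval 0 = 0) (hder : 1 < p.derivative.eval 0)
    (hnofix : ∀ x : ℝ, x < 0 → p.eval x ≠ x) {x : ℝ} (hx : x < 0) : p.eval x < x := by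
  by_contra! hle
  have hd : HasDerivAt (fun y => p.eval y - y) (p.derivative.eval 0 - 1) 0 :=
    (p.hasDerivAt 0).sub (hasDerivAt_id 0)
  have hev : ∀ᶠ y in 𝓝[<] (0 : ℝ), p.eval y - y < 0 := by
    have := (hasDerivAt_iff_tendsto_slope.1 hd).eventually_const_lt (sub_pos.2 hder)
    filter_upwards [nhdsWithin_mono 0 (fun y (hy : y < 0) => hy.ne) this, self_mem_nhdsWithin]
      with y hy hy0
    have hy0 : y < 0 := hy0
    simp only [slope_def_field, h0, sub_zero] at hy
    exact (div_pos_iff.1 hy).elim (fun h => absurd h.2 hy0.not_gt) (fun h => h.1)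
  obtain ⟨y, hy, hy1, hy2⟩ := (hev.and (Ioo_mem_nhdsLT hx)).exists
  obtain ⟨w, hw, hw'⟩ := intermediate_value_Icc' (f := fun y => p.eval y - y) hy1.le (by fun_prop)
    (show (0 : ℝ) ∈ Icc _ _ from ⟨hy.le, by linarith⟩)
  exact hnofix w (hw.2.trans_lt hy2) (sub_eq_zero.1 hw')

theorem ofReal_notMem_filledJulia {p : ℝ[X]} (hlt : ∀ x : ℝ, x < 0 → p.eval x < x) {x : ℝ}
    (hx : x < 0) : (x : ℂ) ∉ filledJulia (p.map (algebraMap ℝ ℂ)) := by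
  intro hmem
  have hcoe : ∀ n : ℕ, (fun w => (p.map (algebraMap ℝ ℂ)).eval w)^[n] (x : ℂ) =
      ((fun y => p.eval y)^[n] x : ℝ) := by
    intro n
    induction n with
    | zero => rfl
    | succ n ih => rw [Function.iterate_succ_apply', Function.iterate_succ_apply', ih,
        eval_map_ofReal]
  have hneg : ∀ n : ℕ, (fun y => p.eval y)^[n] x < 0 := by
    intro n
    induction n with
    | zero => exact hx
    | succ n ih =>
      rw [Function.iterate_succ_apply']
      exact (hlt _ ih).trans ih
  have hanti : Antitone fun n : ℕ => (fun y => p.eval y)^[n] x :=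
    antitone_nat_of_succ_le fun n => by
      rw [Function.iterate_succ_apply']
      exact (hlt _ (hneg n)).le
  obtain ⟨B, hB⟩ := mem_filledJulia.1 hmem
  have hbdd : BddBelow (range fun n : ℕ => (fun y => p.eval y)^[n] x) := by
    refine ⟨-B, ?_⟩
    rintro _ ⟨n, rfl⟩
    have := hB n
    simp only [hcoe, Complex.norm_real, Real.norm_eq_abs] at this
    exact (abs_le.1 this).1
  have hlim := tendsto_atTop_ciInf hanti hbdd
  have hfix := isFixedPt_of_tendsto_iterate hlim p.continuous.continuousAt
  exact (hlt _ ((ciInf_le hbdd 0).trans_lt hx)).ne hfix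

/-- A real polynomial with nonnegative coefficients and `p′(0) > 0` has its real critical points
bounded above by a negative number. -/
theorem exists_neg_forall_isRoot_derivative_le {p : ℝ[X]} (hcoeff : ∀ n, 0 ≤ p.coeff n)
    (hder : 0 < p.derivative.eval 0) :
    ∃ c < 0, ∀ x : ℝ, p.derivative.eval x = 0 → x ≤ c := by
  have hne : p.derivative ≠ 0 := fun h => by simp [h] at hder
  have hneg : ∀ x : ℝ, p.derivative.eval x = 0 → x < 0 := by
    intro x hx
    by_contra! h
    refine hder.not_ge ?_
    rw [← coeff_zero_eq_eval_zero]
    rw [eval_eq_sum_range] at hx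
    have hnn : ∀ i ∈ Finset.range (p.derivative.natDegree + 1),
        0 ≤ p.derivative.coeff i * x ^ i := fun i _ => by
      rw [coeff_derivative]
      have := hcoeff (i + 1)
      positivity
    have := (Finset.sum_eq_zero_iff_of_nonneg hnn).1 hx 0 (by simp)
    simpa using this.le
  obtain hemp | hemp := p.derivative.roots.toFinset.eq_empty_or_nonempty
  · refine ⟨-1, by norm_num, fun x hx => ?_⟩
    have : x ∈ p.derivative.roots.toFinset := by simpa [hne] using hx
    simp [hemp] at this
  · refine ⟨p.derivative.roots.toFinset.max' hemp, ?_, fun x hx => ?_⟩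
    · have := Finset.max'_mem _ hemp
      rw [Multiset.mem_toFinset, mem_roots hne] at this
      exact hneg _ this
    · exact Finset.le_max' _ _ (by simpa [hne] using hx)

end

/-- Let `p` be a real polynomial of degree at least 2 with nonnegative
coefficients, `p(0) = 0` and `p′(0) > 1`. If `p` has no negative real fixed point and
every complex root of `p′` is real, then the Julia set of the induced map `ℂ → ℂ`
is totally disconnected. -/
theorem stmt_13 (p : Polynomial ℝ)
    (hdeg : 2 ≤ p.natDegree)
    (hcoeff : ∀ n, 0 ≤ p.coeff n)
    (h0 : p.eval 0 = 0)
    (hder : 1 < p.derivative.eval 0)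
    (hnofix : ∀ x : ℝ, x < 0 → p.eval x ≠ x)
    (hcrit : ∀ z : ℂ, (p.derivative.map (algebraMap ℝ ℂ)).eval z = 0 → z.im = 0) :
    IsTotallyDisconnected
      (frontier {z : ℂ |
        Bornology.IsBounded
          (Set.range fun n => (fun w => (p.map (algebraMap ℝ ℂ)).eval w)^[n] z)}) := by
  change IsTotallyDisconnected (frontier (filledJulia (p.map (algebraMap ℝ ℂ))))
  have hcpt : IsCompact (filledJulia (p.map (algebraMap ℝ ℂ))) :=
    isCompact_filledJulia (by rwa [Polynomial.natDegree_map])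
  have hlt : ∀ x : ℝ, x < 0 → p.eval x < x := fun x => eval_lt_self_of_neg h0 hder hnofix
  obtain ⟨c, hc, hcle⟩ := exists_neg_forall_isRoot_derivative_le hcoeff (one_pos.trans hder)
  obtain ⟨s, hs, hsle⟩ : ∃ s : ℝ, 0 < s ∧ ∀ x : ℝ, x ≤ c + s ^ 2 → p.eval x ≤ c := by
    obtain ⟨ε, hε, hball⟩ := Metric.eventually_nhds_iff.1
      (p.continuous.continuousAt.eventually_lt_const (hlt c hc))
    refine ⟨√(ε / 2), by positivity, fun x hx => ?_⟩
    rw [Real.sq_sqrt (by positivity)] at hx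
    obtain hxc | hxc := le_total x c
    · exact ((hlt x (hxc.trans_lt hc)).trans_le hxc).le
    · refine (hball ?_).le
      rw [Real.dist_eq, abs_of_nonneg (sub_nonneg.2 hxc)]
      linarith
  suffices h : IsTotallyDisconnected (filledJulia (p.map (algebraMap ℝ ℂ))) from
    fun t ht => h t (ht.trans hcpt.isClosed.frontier_subset)
  refine isTotallyDisconnected_of_slit _ (c := c) hs ?_ ?_ hcpt ?_ (mapsTo_filledJulia _)
  · intro z hz
    rw [Polynomial.derivative_map] at hz
    obtain ⟨x, rfl⟩ : ∃ x : ℝ, z = x := ⟨z.re, Complex.ext rfl (by simpa using hcrit z hz)⟩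
    rw [eval_map_ofReal, Complex.ofReal_eq_zero] at hz
    rw [eval_map_ofReal]
    exact sub_ofReal_notMem_slitPlane (hsle x ((hcle x hz).trans (by nlinarith)))
  · intro z hz
    have hreal : ∀ x : ℝ, x ≤ c + s ^ 2 → z ≠ x := by
      rintro x hx rfl
      rw [eval_map_ofReal] at hz
      exact sub_ofReal_notMem_slitPlane (hsle x hx) hz
    refine ⟨sub_ofReal_mem_slitPlane fun x hx => hreal x (by nlinarith), ?_⟩
    have := sub_ofReal_mem_slitPlane hreal
    push_cast at this
    rwa [← sub_sub] at this
  · intro z hz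
    refine sub_ofReal_mem_slitPlane ?_
    rintro x hx rfl
    exact ofReal_notMem_filledJulia hlt (hx.trans_lt hc) hz
end

section
/- Let a₁, a₂, a₃ be positive real numbers with a₁ > 4 and 4·a₃·(a₁ − 1) < a₂² < 4·a₁·a₃. Let P(z) = a₁z + a₂z² + a₃z³, let δ₁ = (−a₂ − √(a₂² − 4a₃(a₁−1)))/(2a₃) and δ₂ = (−a₂ + √(a₂² − 4a₃(a₁−1)))/(2a₃) be the non-zero fixed points of P, and let c₁ = (−a₂ − √(a₂² − 3a₁a₃))/(3a₃) be the smaller critical point of P. Then P′(δ₁) > 1, and: (1) if a₂²·(a₁−2) < a₃·(2a₁−3)² then 0 < P′(δ₂) < 1 and δ₂ < c₁; (2) if a₂²·(a₁−2) = a₃·(2a₁−3)² then P′(δ₂) = 0 and δ₂ = c₁; (3) if a₃·(2a₁−3)² < a₂²·(a₁−2) and a₂²·(a₁−3) < 4a₃·(a₁−2)² then −1 < P′(δ₂) < 0 and δ₂ > c₁; (4) if a₂²·(a₁−3) = 4a₃·(a₁−2)² then P′(δ₂) = −1 and δ₂ > c₁; (5) if a₂²·(a₁−3) > 4a₃·(a₁−2)²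 then P′(δ₂) < −1 and δ₂ > c₁. -/
/-- For positive reals with `a₁ > 4` and `4a₃(a₁−1) < a₂² < 4a₁a₃`, with
`P(x) = a₁x + a₂x² + a₃x³`, `P′(x) = a₁ + 2a₂x + 3a₃x²`, non-zero fixed points
`δ₁ < δ₂` and smaller critical point `c₁`: the smaller fixed point is repelling
(`P′(δ₁) > 1`), and the five cases on `a₂²` determine the multiplier `P′(δ₂)` and the
position of `δ₂` relative to `c₁`. -/
theorem stmt_17 (a₁ a₂ a₃ : ℝ)
    (h₁ : 0 < a₁) (h₂ : 0 < a₂) (h₃ : 0 < a₃)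
    (ha : 4 < a₁)
    (hlow : 4 * a₃ * (a₁ - 1) < a₂ ^ 2) (hhigh : a₂ ^ 2 < 4 * a₁ * a₃)
    (P P' : ℝ → ℝ)
    (hP : ∀ x, P x = a₁ * x + a₂ * x ^ 2 + a₃ * x ^ 3)
    (hP' : ∀ x, P' x = a₁ + 2 * a₂ * x + 3 * a₃ * x ^ 2)
    (δ₁ δ₂ c₁ : ℝ)
    (hδ₁ : δ₁ = (-a₂ - Real.sqrt (a₂ ^ 2 - 4 * a₃ * (a₁ - 1))) / (2 * a₃))
    (hδ₂ : δ₂ = (-a₂ + Real.sqrt (a₂ ^ 2 - 4 * a₃ * (a₁ - 1))) / (2 * a₃))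
    (hc₁ : c₁ = (-a₂ - Real.sqrt (a₂ ^ 2 - 3 * a₁ * a₃)) / (3 * a₃)) :
    P' δ₁ > 1 ∧
    (a₂ ^ 2 * (a₁ - 2) < a₃ * (2 * a₁ - 3) ^ 2 →
      (0 < P' δ₂ ∧ P' δ₂ < 1) ∧ δ₂ < c₁) ∧
    (a₂ ^ 2 * (a₁ - 2) = a₃ * (2 * a₁ - 3) ^ 2 →
      P' δ₂ = 0 ∧ δ₂ = c₁) ∧
    (a₃ * (2 * a₁ - 3) ^ 2 < a₂ ^ 2 * (a₁ - 2) →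
      a₂ ^ 2 * (a₁ - 3) < 4 * a₃ * (a₁ - 2) ^ 2 →
        (-1 < P' δ₂ ∧ P' δ₂ < 0) ∧ δ₂ > c₁) ∧
    (a₂ ^ 2 * (a₁ - 3) = 4 * a₃ * (a₁ - 2) ^ 2 →
      P' δ₂ = -1 ∧ δ₂ > c₁) ∧
    (a₂ ^ 2 * (a₁ - 3) > 4 * a₃ * (a₁ - 2) ^ 2 →
      P' δ₂ < -1 ∧ δ₂ > c₁) := by
  have hD : 0 < a₂ ^ 2 - 4 * a₃ * (a₁ - 1) := by linarith
  have hT : 0 < a₂ ^ 2 - 3 * a₁ * a₃ := by nlinarith [mul_pos h₃ (sub_pos.2 ha)]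
  have hs := Real.sqrt_pos.2 hD
  have hs2 := Real.sq_sqrt hD.le
  have ht := Real.sqrt_pos.2 hT
  have ht2 := Real.sq_sqrt hT.le
  set s := Real.sqrt (a₂ ^ 2 - 4 * a₃ * (a₁ - 1))
  set t := Real.sqrt (a₂ ^ 2 - 3 * a₁ * a₃)
  have hsa : s < a₂ := by
    have := mul_pos h₃ (show 0 < a₁ - 1 by linarith)
    exact lt_of_pow_lt_pow_left₀ 2 h₂.le (by linarith)
  have e₁ : 2 * a₃ * δ₁ = -a₂ - s := by rw [hδ₁]; field_simp
  have e₂ : 2 * a₃ * δ₂ = -a₂ + s := by rw [hδ₂]; field_simp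
  have ec : 3 * a₃ * c₁ = -a₂ - t := by rw [hc₁]; field_simp
  clear_value s t
  have hm₁ : 2 * a₃ * (P' δ₁ - 1) = s * (a₂ + s) := by
    rw [hP']
    linear_combination (2 * a₂ + 3 / 2 * (2 * a₃ * δ₁ - a₂ - s)) * e₁ + 1 / 2 * hs2
  have hm₂ : 2 * a₃ * (1 - P' δ₂) = s * (a₂ - s) := by
    rw [hP']
    linear_combination -(2 * a₂ + 3 / 2 * (2 * a₃ * δ₂ - a₂ + s)) * e₂ - 1 / 2 * hs2
  have hu : (3 * a₃ * δ₂ + a₂) ^ 2 = t ^ 2 + 3 * a₃ * P' δ₂ := by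
    rw [hP', ht2]; ring
  have hA : 0 < a₂ ^ 2 - 2 * a₃ * (2 * a₁ - 3) + a₂ * s := by
    nlinarith [mul_pos h₂ hs]
  have hB : 0 < a₂ ^ 2 - 4 * a₃ * (a₁ - 2) + a₂ * s := by
    nlinarith [mul_pos h₂ hs]
  have hPA : P' δ₂ * (a₂ ^ 2 - 2 * a₃ * (2 * a₁ - 3) + a₂ * s) =
      2 * (a₃ * (2 * a₁ - 3) ^ 2 - a₂ ^ 2 * (a₁ - 2)) := by
    apply mul_left_cancel₀ (show 2 * a₃ ≠ 0 by positivity)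
    linear_combination (a₂ ^ 2 - 2 * a₃ * (2 * a₁ - 3) + a₂ * s) * (hs2 - hm₂) - a₂ ^ 2 * hs2
  have hPB : (P' δ₂ + 1) * (a₂ ^ 2 - 4 * a₃ * (a₁ - 2) + a₂ * s) =
      2 * (4 * a₃ * (a₁ - 2) ^ 2 - a₂ ^ 2 * (a₁ - 3)) := by
    apply mul_left_cancel₀ (show 2 * a₃ ≠ 0 by positivity)
    linear_combination (a₂ ^ 2 - 4 * a₃ * (a₁ - 2) + a₂ * s) * (hs2 - hm₂) - a₂ ^ 2 * hs2
  have hc_of_neg (h : P' δ₂ < 0) : δ₂ > c₁ := by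
    have h3 := mul_neg_of_pos_of_neg h₃ h
    have h4 := (abs_lt.1 (abs_lt_of_sq_lt_sq (by linarith) ht.le :
      |3 * a₃ * δ₂ + a₂| < t)).1
    exact lt_of_mul_lt_mul_left (by linarith : 3 * a₃ * c₁ < 3 * a₃ * δ₂) (by positivity)
  have hu_neg (h : a₂ ^ 2 * (a₁ - 2) ≤ a₃ * (2 * a₁ - 3) ^ 2) : 3 * a₃ * δ₂ + a₂ < 0 := by
    have h5 : (3 * s) ^ 2 < a₂ ^ 2 := by
      have h6 : 0 < a₃ * (a₁ * (a₁ - 3)) :=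
        mul_pos h₃ (mul_pos h₁ (by linarith))
      have h7 : 0 < (a₂ ^ 2 - (3 * s) ^ 2) * (a₁ - 2) := by
        rw [mul_pow, hs2]; linarith
      exact sub_pos.1 (pos_of_mul_pos_left h7 (by linarith))
    have := lt_of_pow_lt_pow_left₀ 2 h₂.le h5
    linarith
  refine ⟨?_, fun h => ?_, fun h => ?_, fun h h' => ?_, fun h => ?_, fun h => ?_⟩
  · have : 0 < 2 * a₃ * (P' δ₁ - 1) := hm₁ ▸ by positivity
    exact sub_pos.1 (pos_of_mul_pos_right this (by positivity))
  · have hp : 0 < P' δ₂ := pos_of_mul_pos_left (hPA ▸ by linarith) hA.le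
    have hlt : 0 < 2 * a₃ * (1 - P' δ₂) := hm₂ ▸ mul_pos hs (sub_pos.2 hsa)
    refine ⟨⟨hp, sub_pos.1 (pos_of_mul_pos_right hlt (by positivity))⟩, ?_⟩
    have h3 := mul_pos h₃ hp
    have h4 : t < -(3 * a₃ * δ₂ + a₂) :=
      lt_of_pow_lt_pow_left₀ 2 (by linarith [hu_neg h.le]) (by rw [neg_sq]; linarith)
    exact lt_of_mul_lt_mul_left (by linarith : 3 * a₃ * δ₂ < 3 * a₃ * c₁) (by positivity)
  · have hp : P' δ₂ = 0 :=
      (mul_eq_zero.1 (hPA.trans (by rw [h]; ring))).resolve_right hA.ne'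
    refine ⟨hp, ?_⟩
    rw [hp, mul_zero, add_zero] at hu
    have h4 : 3 * a₃ * δ₂ + a₂ = -t :=
      (sq_eq_sq_iff_eq_or_eq_neg.1 hu).resolve_left (by linarith [hu_neg h.le])
    exact mul_left_cancel₀ (show 3 * a₃ ≠ 0 by positivity) (by linarith)
  · have hp : P' δ₂ < 0 := neg_of_mul_neg_left (hPA ▸ by linarith) hA.le
    have hp' : 0 < P' δ₂ + 1 := pos_of_mul_pos_left (hPB ▸ by linarith) hB.le
    exact ⟨⟨by linarith, hp⟩, hc_of_neg hp⟩
  · have hp : P' δ₂ + 1 = 0 :=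
      (mul_eq_zero.1 (hPB.trans (by rw [h]; ring))).resolve_right hB.ne'
    exact ⟨by linarith, hc_of_neg (by linarith)⟩
  · have hp : P' δ₂ + 1 < 0 := neg_of_mul_neg_left (hPB ▸ by linarith) hB.le
    exact ⟨by linarith, hc_of_neg (by linarith)⟩
end

section
/- Let a₁, a₂, a₃ be positive real numbers with 4·a₃·(a₁ − 1) < a₂² < 4·a₁·a₃. Let P(x) = a₁x + a₂x² + a₃x³ on ℝ, let δ₁ = (−a₂ − √(a₂² − 4a₃(a₁−1)))/(2a₃) be the smaller fixed point of P, and let c₁ = (−a₂ − √(a₂² − 3a₁a₃))/(3a₃) and c₂ = (−a₂ + √(a₂² − 3a₁a₃))/(3a₃) be the two real critical points of P. Then: (1) if δ₁ ≤ P(c₂), then P maps the interval [δ₁, 0] into itself and the forward orbits {P^[n](c₁)} and {P^[n](c₂)} of both critical points are bounded; (2) if P(c₂) < δ₁, then P^[n](c₂) → −∞ as n → ∞. -/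
open Filter

/-- A difference quotient of a cubic is the Simpson average of its derivative. -/
theorem cubic_sub_eq (a₁ a₂ a₃ x y : ℝ) :
    (a₁ * x + a₂ * x ^ 2 + a₃ * x ^ 3) - (a₁ * y + a₂ * y ^ 2 + a₃ * y ^ 3) =
      (x - y) * (((a₁ + 2 * a₂ * x + 3 * a₃ * x ^ 2) + (a₁ + 2 * a₂ * y + 3 * a₃ * y ^ 2) +
        4 * (a₁ + 2 * a₂ * ((x + y) / 2) + 3 * a₃ * ((x + y) / 2) ^ 2)) / 6) := by
  ring

/-- A real sequence of iterates that drops by at least `ε` below `y₀` tends to `-∞`. -/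
theorem tendsto_iterate_atBot_of_le_sub {f : ℝ → ℝ} {y₀ ε : ℝ} (hε : 0 < ε)
    (h : ∀ y ≤ y₀, f y ≤ y - ε) : Tendsto (fun n => f^[n] y₀) atTop atBot := by
  have key : ∀ n : ℕ, f^[n] y₀ ≤ y₀ - n * ε := by
    intro n
    induction n with
    | zero => simp
    | succ k ih =>
      rw [Function.iterate_succ_apply']
      have hk : (0 : ℝ) ≤ k * ε := by positivity
      have := h _ (ih.trans (by linarith))
      push_cast
      linarith
  refine tendsto_atBot_mono key ?_
  have : Tendsto (fun n : ℕ => (n : ℝ) * ε) atTop atTop :=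
    tendsto_natCast_atTop_atTop.atTop_mul_const hε
  simpa [sub_eq_add_neg] using tendsto_atBot_add_const_left atTop y₀ (tendsto_neg_atTop_atBot.comp this)

/-- Orbits starting in an invariant compact interval are bounded. -/
theorem isBounded_range_iterate_of_mapsTo_Icc {f : ℝ → ℝ} {a b x : ℝ}
    (h : Set.MapsTo f (Set.Icc a b) (Set.Icc a b)) (hx : x ∈ Set.Icc a b) :
    Bornology.IsBounded (Set.range fun n => f^[n] x) :=
  (Metric.isBounded_Icc a b).subset (Set.range_subset_iff.2 fun n => h.iterate n hx)

/-- For positive reals with `4a₃(a₁−1) < a₂² < 4a₁a₃`, with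
`P(x) = a₁x + a₂x² + a₃x³`, smaller fixed point `δ₁` and real critical points
`c₁ < c₂`: (1) if `δ₁ ≤ P(c₂)` then `P` maps `[δ₁,0]` into itself and both critical
orbits are bounded; (2) if `P(c₂) < δ₁` then `P^[n](c₂) → −∞`. -/
theorem stmt_18 (a₁ a₂ a₃ : ℝ)
    (h₁ : 0 < a₁) (h₂ : 0 < a₂) (h₃ : 0 < a₃)
    (hlow : 4 * a₃ * (a₁ - 1) < a₂ ^ 2) (hhigh : a₂ ^ 2 < 4 * a₁ * a₃)
    (P : ℝ → ℝ)
    (hP : ∀ x, P x = a₁ * x + a₂ * x ^ 2 + a₃ * x ^ 3)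
    (δ₁ c₁ c₂ : ℝ)
    (hδ₁ : δ₁ = (-a₂ - Real.sqrt (a₂ ^ 2 - 4 * a₃ * (a₁ - 1))) / (2 * a₃))
    (hc₁ : c₁ = (-a₂ - Real.sqrt (a₂ ^ 2 - 3 * a₁ * a₃)) / (3 * a₃))
    (hc₂ : c₂ = (-a₂ + Real.sqrt (a₂ ^ 2 - 3 * a₁ * a₃)) / (3 * a₃)) :
    (δ₁ ≤ P c₂ →
      Set.MapsTo P (Set.Icc δ₁ 0) (Set.Icc δ₁ 0) ∧
        Bornology.IsBounded (Set.range fun n => P^[n] c₁) ∧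
        Bornology.IsBounded (Set.range fun n => P^[n] c₂)) ∧
    (P c₂ < δ₁ →
      Tendsto (fun n => P^[n] c₂) atTop atBot) := by
  obtain ⟨e, hfix, hde, hd0⟩ : ∃ e, (∀ x, P x - x = a₃ * x * (x - δ₁) * (x - e)) ∧
      δ₁ < e ∧ δ₁ < 0 := by
    have hs := Real.sq_sqrt (sub_nonneg.2 hlow.le)
    have hs0 := Real.sqrt_pos.2 (sub_pos.2 hlow)
    set s := Real.sqrt (a₂ ^ 2 - 4 * a₃ * (a₁ - 1))
    refine ⟨(-a₂ + s) / (2 * a₃), fun x => ?_, ?_, ?_⟩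
    · rw [hP, hδ₁]
      field_simp
      linear_combination x * hs
    · rw [hδ₁]
      gcongr
      linarith
    · rw [hδ₁]
      exact div_neg_of_neg_of_pos (by linarith) (by positivity)
  have hPd : P δ₁ = δ₁ := by linear_combination hfix δ₁
  have hc12 : c₁ ≤ c₂ := by
    rw [hc₁, hc₂]
    gcongr
    linarith [Real.sqrt_nonneg (a₂ ^ 2 - 3 * a₁ * a₃)]
  have hc20 : c₂ ≤ 0 := by
    rw [hc₂]
    refine div_nonpos_of_nonpos_of_nonneg ?_ (by positivity)
    have : Real.sqrt (a₂ ^ 2 - 3 * a₁ * a₃) ≤ a₂ :=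
      Real.sqrt_le_iff.2 ⟨h₂.le, by nlinarith [mul_pos h₁ h₃]⟩
    linarith
  constructor
  · intro hPc
    have hmain : δ₁ ≤ c₁ ∧ ∀ x, δ₁ ≤ x → δ₁ ≤ P x := by
      have hdiff := cubic_sub_eq a₁ a₂ a₃
      simp only [← hP] at hdiff
      rcases le_or_gt 0 (a₂ ^ 2 - 3 * a₁ * a₃) with hD | hD
      · have hder : ∀ t, a₁ + 2 * a₂ * t + 3 * a₃ * t ^ 2 = 3 * a₃ * (t - c₁) * (t - c₂) := by
          intro t
          have hs := Real.sq_sqrt hD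
          rw [hc₁, hc₂]
          generalize Real.sqrt (a₂ ^ 2 - 3 * a₁ * a₃) = s at hs
          field_simp
          linear_combination hs
        have htangent : ∀ x, P x - P c₂ = a₃ * (x - c₂) ^ 2 * (x - c₁ + (c₂ - c₁) / 2) := by
          intro x
          rw [hdiff]
          simp only [hder]
          ring
        have hdc2 : δ₁ ≤ c₂ := by
          by_contra! hlt
          have := htangent δ₁
          have : 0 < a₃ * (δ₁ - c₂) ^ 2 * (δ₁ - c₁ + (c₂ - c₁) / 2) :=
            mul_pos (mul_pos h₃ (pow_pos (sub_pos.2 hlt) 2)) (by linarith)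
          linarith
        have hdc1 : δ₁ ≤ c₁ := by
          by_contra! hlt
          have hpos : 0 < 1 + a₃ * (δ₁ * (δ₁ - e)) := by
            have := mul_pos h₃ (mul_pos_of_neg_of_neg hd0 (sub_neg.2 hde))
            linarith
          have hderd : a₁ + 2 * a₂ * δ₁ + 3 * a₃ * δ₁ ^ 2 = 1 + a₃ * (δ₁ * (δ₁ - e)) := by
            have hA := hfix 1
            have hB := hfix (-1)
            have hC := hfix 2
            rw [hP] at hA hB hC
            grind
          have := hder δ₁
          have : 3 * a₃ * (δ₁ - c₁) * (δ₁ - c₂) ≤ 0 :=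
            mul_nonpos_of_nonneg_of_nonpos
              (mul_nonneg (by positivity) (sub_nonneg.2 hlt.le)) (sub_nonpos.2 hdc2)
          linarith
        refine ⟨hdc1, fun x hx => ?_⟩
        rcases le_total x c₁ with hxc | hxc
        · have hnn : ∀ t ≤ c₁, 0 ≤ a₁ + 2 * a₂ * t + 3 * a₃ * t ^ 2 := fun t ht => by
            rw [hder, mul_assoc]
            exact mul_nonneg (by positivity)
              (mul_nonneg_of_nonpos_of_nonpos (by linarith) (by linarith))
          have hm := hnn ((x + δ₁) / 2) (by linarith)
          have := mul_nonneg (sub_nonneg.2 hx)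
            (div_nonneg (add_nonneg (add_nonneg (hnn x hxc) (hnn δ₁ hdc1))
              (mul_nonneg zero_le_four hm)) (by norm_num : (0 : ℝ) ≤ 6))
          rw [← hdiff] at this
          linarith
        · have : 0 ≤ a₃ * (x - c₂) ^ 2 * (x - c₁ + (c₂ - c₁) / 2) :=
            mul_nonneg (by positivity) (by linarith)
          rw [← htangent] at this
          linarith
      · have hpos : ∀ t, 0 < a₁ + 2 * a₂ * t + 3 * a₃ * t ^ 2 := fun t => by
          nlinarith [sq_nonneg (3 * a₃ * t + a₂)]
        have hmono : StrictMono P := fun y x hyx => by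
          rw [← sub_pos, hdiff]
          have := hpos x
          have := hpos y
          have := hpos ((x + y) / 2)
          exact mul_pos (sub_pos.2 hyx) (by linarith)
        have hcc : c₁ = c₂ := by
          rw [hc₁, hc₂, Real.sqrt_eq_zero_of_nonpos hD.le, sub_zero, add_zero]
        refine ⟨?_, fun x hx => hPd ▸ hmono.monotone hx⟩
        rw [hcc, ← hmono.le_iff_le, hPd]
        exact hPc
    obtain ⟨hdc1, hlb⟩ := hmain
    have hmaps : Set.MapsTo P (Set.Icc δ₁ 0) (Set.Icc δ₁ 0) := fun x hx => by
      refine ⟨hlb x hx.1, ?_⟩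
      have hq : 0 ≤ a₁ + a₂ * x + a₃ * x ^ 2 := by
        nlinarith [sq_nonneg (2 * a₃ * x + a₂)]
      rw [hP]
      linarith [mul_nonpos_of_nonpos_of_nonneg hx.2 hq]
    exact ⟨hmaps, isBounded_range_iterate_of_mapsTo_Icc hmaps ⟨hdc1, hc12.trans hc20⟩,
      isBounded_range_iterate_of_mapsTo_Icc hmaps ⟨hdc1.trans hc12, hc20⟩⟩
  · intro hPc
    rw [← tendsto_add_atTop_iff_nat 1]
    simp only [Function.iterate_succ_apply]
    refine tendsto_iterate_atBot_of_le_sub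
      (ε := a₃ * (-δ₁) * (δ₁ - P c₂) * (e - δ₁)) ?_ fun y hy => ?_
    · exact mul_pos (mul_pos (mul_pos h₃ (neg_pos.2 hd0)) (sub_pos.2 hPc)) (sub_pos.2 hde)
    · have hle : a₃ * (-δ₁) * (δ₁ - P c₂) * (e - δ₁) ≤ a₃ * (-y) * (δ₁ - y) * (e - y) := by
        have hyd : 0 ≤ δ₁ - y := by linarith
        have hy0 : 0 ≤ -y := by linarith
        have hed : 0 ≤ e - δ₁ := by linarith
        have hcd : 0 ≤ δ₁ - P c₂ := by linarith
        gcongr <;> linarith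
      linarith [hfix y]
end

section
/- Let G be a finite simple graph on exactly 6 vertices that contains a 3-element independent set but no 4-element independent set. If G has exactly 12 independent sets of size 2 (equivalently, exactly 3 edges), then G has exactly 8 independent sets of size 3. -/
/-- If a graph on six vertices has no independent 4-set, then no two vertices meet every edge. -/
theorem exists_adj_avoiding_pair {V : Type*} [Fintype V] [DecidableEq V] (G : SimpleGraph V)
    (hcard : Fintype.card V = 6)
    (h : ¬ ∃ s : Finset V, s.card = 4 ∧ ∀ u ∈ s, ∀ v ∈ s, ¬ G.Adj u v) (x y : V) :
    ∃ u v, G.Adj u v ∧ u ≠ x ∧ u ≠ y ∧ v ≠ x ∧ v ≠ y := by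
  have hc : 4 ≤ ({x, y} : Finset V)ᶜ.card := by
    have := Finset.card_le_two (a := x) (b := y)
    rw [Finset.card_compl]
    omega
  obtain ⟨s, hs, hs4⟩ := Finset.exists_subset_card_eq hc
  by_contra! hne
  refine h ⟨s, hs4, fun u hu v hv huv => ?_⟩
  have hu' := hs hu
  have hv' := hs hv
  simp only [Finset.mem_compl, Finset.mem_insert, Finset.mem_singleton, not_or] at hu' hv'
  exact hv'.2 (hne u v huv hu'.1 hu'.2 hv'.1)

/-- A graph on six vertices with exactly twelve independent pairs has exactly three edges. -/
theorem exists_three_edges {V : Type*} [Fintype V] [DecidableEq V]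
    (G : SimpleGraph V) [DecidableRel G.Adj] (hcard : Fintype.card V = 6)
    (h2 : (Finset.univ.filter
      (fun s : Finset V => s.card = 2 ∧ ∀ u ∈ s, ∀ v ∈ s, ¬ G.Adj u v)).card = 12) :
    ∃ a b c d e f : V, ∀ u v, G.Adj u v ↔ u ≠ v ∧
      (({u, v} : Finset V) = {a, b} ∨ ({u, v} : Finset V) = {c, d} ∨
        ({u, v} : Finset V) = {e, f}) := by
  have hsum := Finset.card_filter_add_card_filter_not (s := Finset.powersetCard 2 Finset.univ)
    (fun s : Finset V => ∀ u ∈ s, ∀ v ∈ s, ¬ G.Adj u v)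
  have hind : (Finset.powersetCard 2 Finset.univ).filter
      (fun s : Finset V => ∀ u ∈ s, ∀ v ∈ s, ¬ G.Adj u v) = Finset.univ.filter
      (fun s : Finset V => s.card = 2 ∧ ∀ u ∈ s, ∀ v ∈ s, ¬ G.Adj u v) := by
    ext s
    simp [Finset.mem_powersetCard]
  rw [hind, h2, Finset.card_powersetCard, Finset.card_univ, hcard,
    show Nat.choose 6 2 = 15 from rfl] at hsum
  obtain ⟨p, q, r, -, -, -, hpqr⟩ := Finset.card_eq_three.mp (Nat.add_left_cancel hsum)
  have hcard2 (s : Finset V) (hs : s ∈ ({p, q, r} : Finset (Finset V))) : ∃ a b, s = {a, b} := by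
    rw [← hpqr, Finset.mem_filter, Finset.mem_powersetCard] at hs
    obtain ⟨a, b, -, h⟩ := Finset.card_eq_two.mp hs.1.2
    exact ⟨a, b, h⟩
  obtain ⟨a, b, rfl⟩ := hcard2 p (by simp)
  obtain ⟨c, d, rfl⟩ := hcard2 q (by simp)
  obtain ⟨e, f, rfl⟩ := hcard2 r (by simp)
  refine ⟨a, b, c, d, e, f, fun u v => ?_⟩
  have hmem := Finset.ext_iff.mp hpqr {u, v}
  simp only [Finset.mem_filter, Finset.mem_powersetCard, Finset.subset_univ, true_and,
    Finset.mem_insert, Finset.mem_singleton] at hmem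
  rw [← hmem]
  constructor
  · intro h
    exact ⟨h.ne, Finset.card_pair h.ne, fun hn => hn u (.inl rfl) v (.inr rfl) h⟩
  · rintro ⟨-, -, hn⟩
    by_contra huv
    refine hn ?_
    rintro x (rfl | rfl) y (rfl | rfl)
    exacts [G.irrefl, huv, fun h => huv h.symm, G.irrefl]

/-- The number of independent 3-sets in a perfect matching on six vertices. -/
theorem card_indep_three_matching :
    (Finset.univ.filter (fun s : Finset (Fin 6) => s.card = 3 ∧
      ∀ i ∈ s, ∀ j ∈ s, ¬ (i ≠ j ∧ i.val / 2 = j.val / 2))).card = 8 := by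
  decide


/-- A finite simple graph on exactly 6 vertices with a 3-element
independent set, no 4-element independent set, and exactly 12 independent sets of
size 2, has exactly 8 independent sets of size 3. -/
theorem stmt_19 {V : Type*} [Fintype V] [DecidableEq V]
    (G : SimpleGraph V) [DecidableRel G.Adj]
    (hcard : Fintype.card V = 6)
    (hindep3 : ∃ s : Finset V, s.card = 3 ∧ ∀ u ∈ s, ∀ v ∈ s, ¬ G.Adj u v)
    (hindep4 : ¬ ∃ s : Finset V, s.card = 4 ∧ ∀ u ∈ s, ∀ v ∈ s, ¬ G.Adj u v)
    (h2 : (Finset.univ.filter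
      (fun s : Finset V => s.card = 2 ∧ ∀ u ∈ s, ∀ v ∈ s, ¬ G.Adj u v)).card = 12) :
    (Finset.univ.filter
      (fun s : Finset V => s.card = 3 ∧ ∀ u ∈ s, ∀ v ∈ s, ¬ G.Adj u v)).card = 8 := by
  obtain ⟨a, b, c, d, e, f, hadj⟩ := exists_three_edges G hcard h2
  have havoid := exists_adj_avoiding_pair G hcard hindep4
  have hpair (u v x y : V) : ({u, v} : Finset V) = {x, y} ↔ (u = x ∧ v = y) ∨ (u = y ∧ v = x) := by
    rw [← Finset.coe_inj, Finset.coe_pair, Finset.coe_pair, Set.pair_eq_pair_iff]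
  simp only [hpair] at hadj
  have hce := havoid c e
  have hcf := havoid c f
  have hde := havoid d e
  have hdf := havoid d f
  have hae := havoid a e
  have hbe := havoid b e
  have haf := havoid a f
  have hbf := havoid b f
  have hac := havoid a c
  have had := havoid a d
  have hbc := havoid b c
  have hbd := havoid b d
  simp only [hadj] at hce hcf hde hdf hae hbe haf hbf hac had hbc hbd
  have hinj : Function.Injective ![a, b, c, d, e, f] := by
    have h₁ : a ≠ b ∧ a ≠ c ∧ a ≠ d ∧ a ≠ e ∧ a ≠ f := by grind
    have h₂ : b ≠ c ∧ b ≠ d ∧ b ≠ e ∧ b ≠ f := by grind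
    have h₃ : c ≠ d ∧ c ≠ e ∧ c ≠ f := by grind
    have h₄ : d ≠ e ∧ d ≠ f ∧ e ≠ f := by grind
    exact List.nodup_ofFn.mp (by simp [h₁, h₂, h₃, h₄])
  let φ : Fin 6 ≃ V := Equiv.ofBijective _
    ((Fintype.bijective_iff_injective_and_card _).mpr ⟨hinj, by simp [hcard]⟩)
  have hφ (i j : Fin 6) : G.Adj (φ i) (φ j) ↔ i ≠ j ∧ i.val / 2 = j.val / 2 := by
    have e0 : a = φ 0 := rfl
    have e1 : b = φ 1 := rfl
    have e2 : c = φ 2 := rfl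
    have e3 : d = φ 3 := rfl
    have e4 : e = φ 4 := rfl
    have e5 : f = φ 5 := rfl
    rw [hadj, e0, e1, e2, e3, e4, e5]
    simp only [ne_eq, φ.injective.eq_iff]
    revert i j
    decide
  rw [← card_indep_three_matching]
  refine (Finset.card_equiv φ.finsetCongr fun s => ?_).symm
  simp only [Finset.mem_filter, Finset.mem_univ, true_and, Equiv.finsetCongr_apply,
    Finset.card_map, Finset.forall_mem_map, Equiv.coe_toEmbedding, hφ]
end
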